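/- arXiv:2107.13863 — 3 statements merged into one kernel-verified Lean document; each statement's English description precedes it below -/
import Mathlib

section
/- For every X in the Orlicz heart H^{Φ*}, the divergence risk measure ρ^Φ admits the optimized-certainty-equivalent representation ρ^Φ(X) = inf_{x∈ℝ} E[Φ*(X + x) − x]. -/
open MeasureTheory ProbabilityTheory Filter Set
open scoped ENNReal NNReal

noncomputable section

/-- `IsFenchelConjugate Φ Φs` says that `Φs` is the (finite) Fenchel–Legendre transform on `[0, ∞)`
of the extended-valued function `Φ`. -/
def IsFenchelConjugate (Φ : ℝ → ℝ≥0∞) (Φs : ℝ → ℝ) : Prop :=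
  ∀ y : ℝ, IsLUB {r : ℝ | ∃ x : ℝ, 0 ≤ x ∧ Φ x ≠ ⊤ ∧ r = x * y - (Φ x).toReal} (Φs y)

/-- `IsSubgradient f z y` says that the affine function with slope `z` through `(y, f y)` is a
minorant of `f`. -/
def IsSubgradient (f : ℝ → ℝ) (z y : ℝ) : Prop :=
  ∀ u : ℝ, f y + z * (u - y) ≤ f u

namespace IsFenchelConjugate

variable {Φ : ℝ → ℝ≥0∞} {Φs : ℝ → ℝ}

lemma fenchel_young (h : IsFenchelConjugate Φ Φs) {x : ℝ} (hx : 0 ≤ x) (hΦx : Φ x ≠ ⊤) (y : ℝ) :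
    x * y - (Φ x).toReal ≤ Φs y :=
  (h y).1 ⟨x, hx, hΦx, rfl⟩

lemma monotone (h : IsFenchelConjugate Φ Φs) : Monotone Φs := by
  intro y₁ y₂ hy
  refine (h y₁).2 ?_
  rintro r ⟨x, hx, hΦx, rfl⟩
  have := h.fenchel_young hx hΦx y₂
  nlinarith

lemma convexOn (h : IsFenchelConjugate Φ Φs) : ConvexOn ℝ univ Φs := by
  refine ⟨convex_univ, fun y₁ _ y₂ _ a b ha hb hab => (h _).2 ?_⟩
  rintro r ⟨x, hx, hΦx, rfl⟩
  have h₁ := mul_le_mul_of_nonneg_left (h.fenchel_young hx hΦx y₁) ha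
  have h₂ := mul_le_mul_of_nonneg_left (h.fenchel_young hx hΦx y₂) hb
  have hΦ : (Φ x).toReal = a * (Φ x).toReal + b * (Φ x).toReal := by rw [← add_mul, hab, one_mul]
  simp only [smul_eq_mul]
  linarith

lemma exists_eq (h : IsFenchelConjugate Φ Φs) (hlsc : LowerSemicontinuous Φ) (hΦ0 : Φ 0 ≠ ⊤)
    (hgrow : ∀ c : ℝ, ∀ᶠ x : ℝ in atTop, ENNReal.ofReal (c * x) ≤ Φ x) (y : ℝ) :
    ∃ x : ℝ, 0 ≤ x ∧ Φ x ≠ ⊤ ∧ Φs y = x * y - (Φ x).toReal := by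
  obtain ⟨R, hR⟩ := eventually_atTop.1 (hgrow (y + 1))
  set M : ℝ := max R (Φ 0).toReal
  have hM0 : 0 ≤ M := ENNReal.toReal_nonneg.trans (le_max_right _ _)
  let g : ℝ → ℝ≥0∞ := fun x => Φ x + ENNReal.ofReal (|y| * M - x * y)
  have hg : LowerSemicontinuous g :=
    hlsc.add (ENNReal.continuous_ofReal.comp
      (by fun_prop : Continuous fun x : ℝ => |y| * M - x * y)).lowerSemicontinuous
  obtain ⟨x, hxM, hmin⟩ := LowerSemicontinuousOn.exists_isMinOn
    (nonempty_Icc.2 hM0) isCompact_Icc (hg.lowerSemicontinuousOn (Icc 0 M))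
  have hmin' : ∀ u ∈ Icc 0 M, g x ≤ g u := isMinOn_iff.1 hmin
  have hx0 : 0 ≤ x := hxM.1
  have hnn : ∀ u ∈ Icc 0 M, 0 ≤ |y| * M - u * y := fun u hu => by
    have h₁ : u * y ≤ u * |y| := mul_le_mul_of_nonneg_left (le_abs_self y) hu.1
    have h₂ : u * |y| ≤ M * |y| := mul_le_mul_of_nonneg_right hu.2 (abs_nonneg y)
    linarith
  have hfin : ∀ u, Φ u ≠ ⊤ → g u ≠ ⊤ := fun u hu => ENNReal.add_ne_top.2 ⟨hu, ENNReal.ofReal_ne_top⟩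
  have hΦx : Φ x ≠ ⊤ :=
    (ENNReal.add_ne_top.1 (ne_top_of_le_ne_top (hfin 0 hΦ0) (hmin' 0 ⟨le_rfl, hM0⟩))).1
  have hcmp : ∀ u ∈ Icc 0 M, Φ u ≠ ⊤ → u * y - (Φ u).toReal ≤ x * y - (Φ x).toReal := by
    intro u hu hΦu
    have h₁ := ENNReal.toReal_mono (hfin u hΦu) (hmin' u hu)
    simp only [g] at h₁
    rw [ENNReal.toReal_add hΦx ENNReal.ofReal_ne_top, ENNReal.toReal_add hΦu ENNReal.ofReal_ne_top,
      ENNReal.toReal_ofReal (hnn x hxM), ENNReal.toReal_ofReal (hnn u hu)] at h₁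
    linarith
  refine ⟨x, hx0, hΦx, le_antisymm ((h y).2 ?_) (h.fenchel_young hx0 hΦx y)⟩
  rintro r ⟨u, hu, hΦu, rfl⟩
  rcases le_total u M with huM | huM
  · exact hcmp u ⟨hu, huM⟩ hΦu
  · have h₁ := (ENNReal.ofReal_le_iff_le_toReal hΦu).1 (hR u ((le_max_left _ _).trans huM))
    have h₂ := hcmp 0 ⟨le_rfl, hM0⟩ hΦ0
    have h₃ : (Φ 0).toReal ≤ u := (le_max_right _ _).trans huM
    linarith

/-- Equality in the Fenchel–Young inequality at a subgradient of the conjugate. -/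
lemma eq_of_isSubgradient (h : IsFenchelConjugate Φ Φs) (hlsc : LowerSemicontinuous Φ)
    (hconv : ∀ x y a b : ℝ, 0 ≤ x → 0 ≤ y → 0 ≤ a → 0 ≤ b → a + b = 1 →
      Φ (a * x + b * y) ≤ ENNReal.ofReal a * Φ x + ENNReal.ofReal b * Φ y)
    (hΦ0 : Φ 0 ≠ ⊤) (hgrow : ∀ c : ℝ, ∀ᶠ x : ℝ in atTop, ENNReal.ofReal (c * x) ≤ Φ x)
    {z y : ℝ} (hz : IsSubgradient Φs z y) :
    0 ≤ z ∧ Φ z ≠ ⊤ ∧ (Φ z).toReal = z * y - Φs y := by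
  have key : ∀ t : ℝ, 0 < t → t ≤ 1 →
      0 ≤ z ∧ Φ z ≠ ⊤ ∧ (Φ z).toReal ≤ z * y - Φs y + t * (2 * (Φs (y + 2) - Φs y)) := by
    intro t ht ht1
    obtain ⟨p, hp0, hΦp, hp⟩ := h.exists_eq hlsc hΦ0 hgrow (y + t)
    obtain ⟨q, hq0, hΦq, hq⟩ := h.exists_eq hlsc hΦ0 hgrow (y - t)
    have hzp : z ≤ p := by
      have h₁ := h.fenchel_young hp0 hΦp y
      have h₂ := hz (y + t)
      nlinarith
    have hqz : q ≤ z := by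
      have h₁ := h.fenchel_young hq0 hΦq y
      have h₂ := hz (y - t)
      nlinarith
    have hpC : p ≤ Φs (y + 2) - Φs y := by
      have h₁ := h.fenchel_young hp0 hΦp (y + t + 1)
      have h₂ := h.monotone (by linarith : y + t + 1 ≤ y + 2)
      have h₃ := h.monotone (by linarith : y ≤ y + t)
      linarith
    obtain ⟨a, b, ha, hb, hab, hz'⟩ : ∃ a b : ℝ, 0 ≤ a ∧ 0 ≤ b ∧ a + b = 1 ∧ a * q + b * p = z := by
      have hmem : z ∈ segment ℝ q p := by
        rw [segment_eq_Icc (hqz.trans hzp)]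
        exact ⟨hqz, hzp⟩
      simpa [segment] using hmem
    have hle := hconv q p a b hq0 hp0 ha hb hab
    rw [hz'] at hle
    have hA : ENNReal.ofReal a * Φ q ≠ ⊤ := ENNReal.mul_ne_top ENNReal.ofReal_ne_top hΦq
    have hB : ENNReal.ofReal b * Φ p ≠ ⊤ := ENNReal.mul_ne_top ENNReal.ofReal_ne_top hΦp
    have hle' := ENNReal.toReal_mono (ENNReal.add_ne_top.2 ⟨hA, hB⟩) hle
    rw [ENNReal.toReal_add hA hB, ENNReal.toReal_mul, ENNReal.toReal_mul, ENNReal.toReal_ofReal ha,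
      ENNReal.toReal_ofReal hb] at hle'
    refine ⟨hq0.trans hqz, ne_top_of_le_ne_top (ENNReal.add_ne_top.2 ⟨hA, hB⟩) hle, ?_⟩
    have h₁ : a * (Φ q).toReal ≤ a * (q * (y - t) - Φs y + z * t) :=
      mul_le_mul_of_nonneg_left (by have := hz (y - t); linarith) ha
    have h₂ : b * (Φ p).toReal ≤ b * (p * (y + t) - Φs y - z * t) :=
      mul_le_mul_of_nonneg_left (by have := hz (y + t); linarith) hb
    have h₃ : b * p + a * z ≤ 2 * (Φs (y + 2) - Φs y) := by nlinarith
    have h₄ : 0 ≤ a * q + b * z :=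
      add_nonneg (mul_nonneg ha hq0) (mul_nonneg hb (hq0.trans hqz))
    have hb' : b = 1 - a := by linarith
    calc (Φ z).toReal
        ≤ a * (q * (y - t) - Φs y + z * t) + b * (p * (y + t) - Φs y - z * t) := by linarith
      _ = (a * q + b * p) * y - Φs y + t * ((b * p + a * z) - (a * q + b * z)) := by
          rw [hb']; ring
      _ ≤ z * y - Φs y + t * (2 * (Φs (y + 2) - Φs y)) := by
          rw [hz']
          gcongr
          linarith
  obtain ⟨hz0, hΦz, -⟩ := key 1 one_pos le_rfl
  refine ⟨hz0, hΦz, le_antisymm ?_ (by linarith [h.fenchel_young hz0 hΦz y])⟩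
  have hlim : Tendsto (fun t : ℝ => z * y - Φs y + t * (2 * (Φs (y + 2) - Φs y)))
      (nhdsWithin 0 (Ioi 0)) (nhds (z * y - Φs y)) := by
    have : Continuous fun t : ℝ => z * y - Φs y + t * (2 * (Φs (y + 2) - Φs y)) := by fun_prop
    simpa using (this.tendsto 0).mono_left nhdsWithin_le_nhds
  refine ge_of_tendsto hlim ?_
  filter_upwards [Ioc_mem_nhdsGT (zero_lt_one' ℝ)] with t ht using (key t ht.1 ht.2).2.2

end IsFenchelConjugate

namespace ConvexOn

variable {f : ℝ → ℝ}

lemma isSubgradient_of_mem_Icc (hf : ConvexOn ℝ univ f) {y z : ℝ}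
    (hz : z ∈ Icc (derivWithin f (Iio y) y) (derivWithin f (Ioi y) y)) : IsSubgradient f z y := by
  intro u
  rcases lt_trichotomy u y with hu | rfl | hu
  · have := (hf.slope_le_leftDeriv_of_mem_interior (mem_univ u) (by simp) hu).trans hz.1
    rw [slope_def_field, div_le_iff₀ (by linarith)] at this
    linarith
  · simp
  · have := hz.2.trans (hf.rightDeriv_le_slope_of_mem_interior (by simp) (mem_univ u) hu)
    rw [slope_def_field, le_div_iff₀ (by linarith)] at this
    linarith

lemma abs_div_le (hf : ConvexOn ℝ univ f) (y : ℝ) {s : ℝ} (hs0 : s ≠ 0) (hs : |s| ≤ 1) :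
    |(f (y + s) - f y) / s| ≤ |f y - f (y - 1)| + |f (y + 1) - f y| := by
  have hmono := hf.slope_mono (mem_univ y)
  have hmem : ∀ v : ℝ, v ≠ 0 → y + v ∈ univ \ {y} := fun v hv => by simpa using hv
  have hslope : ∀ v : ℝ, slope f y (y + v) = (f (y + v) - f y) / v := fun v => by
    rw [slope_def_field, add_sub_cancel_left]
  obtain ⟨hl, hu⟩ := abs_le.1 hs
  have h₁ := hmono (hmem (-1) (by norm_num)) (hmem s hs0) (by linarith)
  have h₂ := hmono (hmem s hs0) (hmem 1 one_ne_zero) (by linarith)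
  rw [hslope, hslope] at h₁ h₂
  have h₃ : (f (y + -1) - f y) / -1 = f y - f (y - 1) := by rw [← sub_eq_add_neg]; ring
  rw [h₃] at h₁
  rw [div_one] at h₂
  refine abs_le.2 ⟨?_, ?_⟩
  · linarith [neg_abs_le (f y - f (y - 1)), abs_nonneg (f (y + 1) - f y)]
  · linarith [le_abs_self (f (y + 1) - f y), abs_nonneg (f y - f (y - 1))]

variable {Ω : Type*} [MeasurableSpace Ω] {P : Measure Ω} {Y : Ω → ℝ}

/-- Differentiation under the integral sign along a sequence of increments. -/
lemma tendsto_integral_slope (hf : ConvexOn ℝ univ f)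
    (hint : ∀ t, Integrable (fun ω => f (Y ω + t)) P) {s : ℕ → ℝ} (hs0 : ∀ n, s n ≠ 0)
    (hs : ∀ n, |s n| ≤ 1) {D : Ω → ℝ}
    (hD : ∀ ω, Tendsto (fun n => (f (Y ω + s n) - f (Y ω)) / s n) atTop (nhds (D ω))) :
    Integrable D P ∧ Tendsto (fun n => (∫ ω, f (Y ω + s n) ∂P - ∫ ω, f (Y ω) ∂P) / s n) atTop
      (nhds (∫ ω, D ω ∂P)) := by
  have hint0 : Integrable (fun ω => f (Y ω)) P := by simpa using hint 0
  have hbound : Integrable (fun ω => |f (Y ω) - f (Y ω - 1)| + |f (Y ω + 1) - f (Y ω)|) P :=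
    (hint0.sub (by simpa [sub_eq_add_neg] using hint (-1))).abs.add ((hint 1).sub hint0).abs
  have hquot : ∀ n, Integrable (fun ω => (f (Y ω + s n) - f (Y ω)) / s n) P :=
    fun n => ((hint (s n)).sub hint0).div_const _
  have hle : ∀ n ω, |(f (Y ω + s n) - f (Y ω)) / s n| ≤
      |f (Y ω) - f (Y ω - 1)| + |f (Y ω + 1) - f (Y ω)| :=
    fun n ω => hf.abs_div_le (Y ω) (hs0 n) (hs n)
  refine ⟨?_, ?_⟩
  · refine hbound.mono' (aestronglyMeasurable_of_tendsto_ae atTop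
      (fun n => (hquot n).aestronglyMeasurable) (ae_of_all _ hD)) (ae_of_all _ fun ω => ?_)
    exact le_of_tendsto (hD ω).norm (Eventually.of_forall fun n => hle n ω)
  · have := tendsto_integral_of_dominated_convergence _
      (fun n => (hquot n).aestronglyMeasurable) hbound (fun n => ae_of_all _ (hle n))
      (ae_of_all _ hD)
    refine this.congr fun n => ?_
    rw [integral_div, integral_sub (hint (s n)) hint0]

/-- At a minimizer of `t ↦ 𝔼[f (Y + t)] - t` there is a measurable selection of the subgradient of
`f` along `Y` with mean one. -/
lemma exists_isSubgradient_integral_eq_one (hf : ConvexOn ℝ univ f) (hY : Measurable Y)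
    (hint : ∀ t, Integrable (fun ω => f (Y ω + t)) P)
    (hmin : ∀ t, ∫ ω, f (Y ω) ∂P ≤ ∫ ω, f (Y ω + t) ∂P - t) :
    ∃ Z : Ω → ℝ, Measurable Z ∧ Integrable Z P ∧ ∫ ω, Z ω ∂P = 1 ∧
      ∀ ω, IsSubgradient f (Z ω) (Y ω) := by
  set L : ℝ → ℝ := fun y => derivWithin f (Iio y) y
  set R : ℝ → ℝ := fun y => derivWithin f (Ioi y) y
  have hLm : Measurable L :=
    Monotone.measurable (by simpa [monotoneOn_univ] using hf.monotoneOn_leftDeriv)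
  have hRm : Measurable R :=
    Monotone.measurable (by simpa [monotoneOn_univ] using hf.monotoneOn_rightDeriv)
  have hLR : ∀ y, L y ≤ R y := fun y => hf.leftDeriv_le_rightDeriv_of_mem_interior (by simp)
  have hu : Tendsto (fun n : ℕ => 1 / ((n : ℝ) + 1)) atTop (nhds 0) :=
    tendsto_one_div_add_atTop_nhds_zero_nat
  have hpos : ∀ n : ℕ, 0 < 1 / ((n : ℝ) + 1) := fun n => Nat.one_div_pos_of_nat
  have hle1 : ∀ n : ℕ, |1 / ((n : ℝ) + 1)| ≤ 1 := fun n => by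
    rw [abs_of_pos (hpos n), div_le_one (by positivity)]
    simp
  have hR : ∀ ω, Tendsto (fun n : ℕ => (f (Y ω + 1 / ((n : ℝ) + 1)) - f (Y ω)) /
      (1 / ((n : ℝ) + 1))) atTop (nhds (R (Y ω))) := fun ω => by
    have h₁ := (hasDerivWithinAt_iff_tendsto_slope' self_notMem_Ioi).1
      (hf.hasDerivWithinAt_rightDeriv_of_mem_interior (x := Y ω) (by simp))
    have h₂ : Tendsto (fun n : ℕ => Y ω + 1 / ((n : ℝ) + 1)) atTop (nhdsWithin (Y ω) (Ioi (Y ω))) :=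
      tendsto_nhdsWithin_iff.2 ⟨by simpa using hu.const_add (Y ω),
        Eventually.of_forall fun n => lt_add_of_pos_right _ (hpos n)⟩
    refine (h₁.comp h₂).congr fun n => ?_
    simp only [Function.comp_apply, slope_def_field, add_sub_cancel_left]
  have hL : ∀ ω, Tendsto (fun n : ℕ => (f (Y ω + -(1 / ((n : ℝ) + 1))) - f (Y ω)) /
      (-(1 / ((n : ℝ) + 1)))) atTop (nhds (L (Y ω))) := fun ω => by
    have h₁ := (hasDerivWithinAt_iff_tendsto_slope' self_notMem_Iio).1
      (hf.hasDerivWithinAt_leftDeriv_of_mem_interior (x := Y ω) (by simp))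
    have h₂ : Tendsto (fun n : ℕ => Y ω + -(1 / ((n : ℝ) + 1))) atTop
        (nhdsWithin (Y ω) (Iio (Y ω))) :=
      tendsto_nhdsWithin_iff.2 ⟨by simpa using hu.neg.const_add (Y ω),
        Eventually.of_forall fun n => add_lt_of_neg_right _ (neg_lt_zero.2 (hpos n))⟩
    refine (h₁.comp h₂).congr fun n => ?_
    simp only [Function.comp_apply, slope_def_field, add_sub_cancel_left]
  obtain ⟨hRi, hRt⟩ := hf.tendsto_integral_slope hint (fun n => (hpos n).ne') hle1 hR
  obtain ⟨hLi, hLt⟩ := hf.tendsto_integral_slope hint (fun n => (neg_lt_zero.2 (hpos n)).ne)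
    (fun n => by rw [abs_neg]; exact hle1 n) hL
  have hR1 : 1 ≤ ∫ ω, R (Y ω) ∂P := by
    refine ge_of_tendsto hRt (Eventually.of_forall fun n => ?_)
    rw [le_div_iff₀ (hpos n)]
    linarith [hmin (1 / ((n : ℝ) + 1))]
  have hL1 : ∫ ω, L (Y ω) ∂P ≤ 1 := by
    refine le_of_tendsto hLt (Eventually.of_forall fun n => ?_)
    rw [div_le_iff_of_neg (neg_lt_zero.2 (hpos n))]
    linarith [hmin (-(1 / ((n : ℝ) + 1)))]
  obtain ⟨a, b, ha, hb, hab, h1⟩ : ∃ a b : ℝ, 0 ≤ a ∧ 0 ≤ b ∧ a + b = 1 ∧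
      a * ∫ ω, L (Y ω) ∂P + b * ∫ ω, R (Y ω) ∂P = 1 := by
    have hmem : (1 : ℝ) ∈ segment ℝ (∫ ω, L (Y ω) ∂P) (∫ ω, R (Y ω) ∂P) := by
      rw [segment_eq_Icc (hL1.trans hR1)]
      exact ⟨hL1, hR1⟩
    simpa [segment] using hmem
  refine ⟨fun ω => a * L (Y ω) + b * R (Y ω), ?_, (hLi.const_mul a).add (hRi.const_mul b), ?_,
    fun ω => hf.isSubgradient_of_mem_Icc ?_⟩
  · exact ((hLm.comp hY).const_mul a).add ((hRm.comp hY).const_mul b)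
  · rw [integral_add (hLi.const_mul a) (hRi.const_mul b), integral_const_mul, integral_const_mul,
      h1]
  · rw [← segment_eq_Icc (hLR (Y ω))]
    exact ⟨a, b, ha, hb, hab, rfl⟩

end ConvexOn

namespace IsFenchelConjugate

variable {Φ : ℝ → ℝ≥0∞} {Φs : ℝ → ℝ} {Ω : Type*} [MeasurableSpace Ω] {P : Measure Ω} {X : Ω → ℝ}

lemma neg_le (h : IsFenchelConjugate Φ Φs) (hΦ0 : Φ 0 ≠ ⊤) (y : ℝ) : -(Φ 0).toReal ≤ Φs y := by
  simpa using h.fenchel_young le_rfl hΦ0 y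

lemma integrable_mul_add [IsFiniteMeasure P] (h : IsFenchelConjugate Φ Φs) (hΦ0 : Φ 0 ≠ ⊤)
    (hX : Measurable X)
    (hheart : ∀ c : ℝ, 0 < c → Integrable (fun ω => Φs (c * |X ω|)) P) {c : ℝ} (hc : 0 < c)
    (d : ℝ) : Integrable (fun ω => Φs (c * X ω + d)) P := by
  have hbound : Integrable (fun ω => |Φs ((2 * c) * |X ω|)| + |Φs (2 * d)| + (Φ 0).toReal) P :=
    ((hheart (2 * c) (by positivity)).abs.add (integrable_const _)).add (integrable_const _)
  refine hbound.mono'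
    (h.monotone.measurable.comp ((hX.const_mul c).add_const d)).aestronglyMeasurable
    (ae_of_all _ fun ω => ?_)
  have h₁ : c * X ω + d ≤ (1 / 2 : ℝ) * ((2 * c) * |X ω|) + (1 / 2 : ℝ) * (2 * d) := by
    nlinarith [le_abs_self (X ω)]
  have h₂ := h.convexOn.2 (mem_univ ((2 * c) * |X ω|)) (mem_univ (2 * d))
    (by norm_num : (0 : ℝ) ≤ 1 / 2) (by norm_num : (0 : ℝ) ≤ 1 / 2) (by norm_num)
  simp only [smul_eq_mul] at h₂
  have h₃ := (h.monotone h₁).trans h₂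
  rw [Real.norm_eq_abs]
  refine abs_le.2 ⟨?_, ?_⟩
  · linarith [h.neg_le hΦ0 (c * X ω + d), abs_nonneg (Φs ((2 * c) * |X ω|)),
      abs_nonneg (Φs (2 * d))]
  · linarith [le_abs_self (Φs ((2 * c) * |X ω|)), le_abs_self (Φs (2 * d)),
      abs_nonneg (Φs ((2 * c) * |X ω|)), abs_nonneg (Φs (2 * d)), ENNReal.toReal_nonneg (a := Φ 0)]

lemma integrable_of_integrable_comp_abs [IsFiniteMeasure P] (h : IsFenchelConjugate Φ Φs)
    (hX : Measurable X) {x : ℝ} (hx : 0 < x) (hΦx : Φ x ≠ ⊤)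
    (hint : Integrable (fun ω => Φs |X ω|) P) : Integrable X P := by
  refine Integrable.mono' ((hint.add (integrable_const (Φ x).toReal)).const_mul x⁻¹)
    hX.aestronglyMeasurable (ae_of_all _ fun ω => ?_)
  have := h.fenchel_young hx.le hΦx |X ω|
  simp only [Pi.add_apply]
  rw [Real.norm_eq_abs, le_inv_mul_iff₀ hx]
  linarith

/-- The optimized certainty equivalent is attained. -/
lemma exists_forall_integral_le [IsProbabilityMeasure P] (h : IsFenchelConjugate Φ Φs)
    (hΦ0 : Φ 0 ≠ ⊤) (hΦdom : ∃ x : ℝ, 1 < x ∧ Φ x ≠ ⊤) (hX : Integrable X P)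
    (hint : ∀ t, Integrable (fun ω => Φs (X ω + t)) P) :
    ∃ x, ∀ t, (∫ ω, Φs (X ω + x) ∂P) - x ≤ (∫ ω, Φs (X ω + t) ∂P) - t := by
  obtain ⟨x₀, hx₀, hΦx₀⟩ := hΦdom
  set G : ℝ → ℝ := fun t => (∫ ω, Φs (X ω + t) ∂P) - t
  have hG : ConvexOn ℝ univ G := by
    refine ⟨convex_univ, fun s _ t _ a b ha hb hab => ?_⟩
    have hle : ∫ ω, Φs (X ω + (a * s + b * t)) ∂P ≤
        ∫ ω, (a * Φs (X ω + s) + b * Φs (X ω + t)) ∂P := by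
      refine integral_mono (hint _) (((hint s).const_mul a).add ((hint t).const_mul b)) fun ω => ?_
      have h₁ := h.convexOn.2 (mem_univ (X ω + s)) (mem_univ (X ω + t)) ha hb hab
      simp only [smul_eq_mul] at h₁
      have h₂ : X ω + (a * s + b * t) = a * (X ω + s) + b * (X ω + t) := by
        linear_combination (-X ω) * hab
      simpa only [h₂] using h₁
    rw [integral_add ((hint s).const_mul a) ((hint t).const_mul b), integral_const_mul,
      integral_const_mul] at hle
    simp only [G, smul_eq_mul]
    linarith
  have hcont : Continuous G := by
    rw [← continuousOn_univ]
    exact hG.continuousOn isOpen_univ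
  have hlow₁ : ∀ t, -(Φ 0).toReal - t ≤ G t := fun t => by
    have := integral_mono (integrable_const (-(Φ 0).toReal)) (hint t) fun ω => h.neg_le hΦ0 _
    simp only [integral_const, probReal_univ, one_smul] at this
    simp only [G]
    linarith
  have hlow₂ : ∀ t, (x₀ - 1) * t + (x₀ * ∫ ω, X ω ∂P - (Φ x₀).toReal) ≤ G t := fun t => by
    have := integral_mono (((hX.const_mul x₀).add (integrable_const (x₀ * t - (Φ x₀).toReal))))
      (hint t) fun ω => by
        have := h.fenchel_young (by linarith) hΦx₀ (X ω + t)
        simp only [Pi.add_apply]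
        linarith
    simp only [Pi.add_apply] at this
    rw [integral_add (hX.const_mul x₀) (integrable_const _), integral_const_mul] at this
    simp only [integral_const, probReal_univ, one_smul] at this
    simp only [G]
    linarith
  refine hcont.exists_forall_le ?_
  rw [cocompact_eq_atBot_atTop, tendsto_sup]
  constructor
  · exact tendsto_atTop_mono hlow₁ (tendsto_atTop_add_const_left _ _ tendsto_neg_atBot_atTop)
  · exact tendsto_atTop_mono hlow₂ (tendsto_atTop_add_const_right _ _
      (tendsto_id.const_mul_atTop (by linarith)))

/-- Weak duality. -/
lemma integral_sub_le [IsProbabilityMeasure P] (h : IsFenchelConjugate Φ Φs)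
    (hlsc : LowerSemicontinuous Φ) (hX : Measurable X)
    (hint_abs : Integrable (fun ω => Φs |X ω|) P)
    {Q : Measure Ω} [IsProbabilityMeasure Q] (hQP : Q ≪ P)
    (hQ : ∫⁻ ω, Φ (Q.rnDeriv P ω).toReal ∂P ≠ ⊤) {x : ℝ}
    (hint : Integrable (fun ω => Φs (X ω + x)) P) :
    ∫ ω, X ω ∂Q - (∫⁻ ω, Φ (Q.rnDeriv P ω).toReal ∂P).toReal ≤
      (∫ ω, Φs (X ω + x) ∂P) - x := by
  have hZm : Measurable fun ω => (Q.rnDeriv P ω).toReal :=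
    (Measure.measurable_rnDeriv Q P).ennreal_toReal
  have hΦZm : Measurable fun ω => Φ (Q.rnDeriv P ω).toReal := hlsc.measurable.comp hZm
  have hfin := ae_lt_top hΦZm hQ
  have hΦZ : Integrable (fun ω => (Φ (Q.rnDeriv P ω).toReal).toReal) P :=
    integrable_toReal_of_lintegral_ne_top hΦZm.aemeasurable hQ
  have hZ : Integrable (fun ω => (Q.rnDeriv P ω).toReal) P := Measure.integrable_toReal_rnDeriv
  have hZX : Integrable (fun ω => (Q.rnDeriv P ω).toReal • X ω) P := by
    refine (hint_abs.add hΦZ).mono' (hZm.mul hX).aestronglyMeasurable ?_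
    filter_upwards [hfin] with ω hω
    have := h.fenchel_young ENNReal.toReal_nonneg hω.ne |X ω|
    simp only [Pi.add_apply]
    rw [smul_eq_mul, norm_mul, Real.norm_of_nonneg ENNReal.toReal_nonneg, Real.norm_eq_abs]
    linarith
  have hZ1 : ∫ ω, (Q.rnDeriv P ω).toReal ∂P = 1 := by
    rw [Measure.integral_toReal_rnDeriv hQP, probReal_univ]
  have hle : ∫ ω, ((Q.rnDeriv P ω).toReal • X ω - (Φ (Q.rnDeriv P ω).toReal).toReal) ∂P ≤
      ∫ ω, (Φs (X ω + x) - x * (Q.rnDeriv P ω).toReal) ∂P := by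
    refine integral_mono_ae (hZX.sub hΦZ) (hint.sub (hZ.const_mul x)) ?_
    filter_upwards [hfin] with ω hω
    have := h.fenchel_young ENNReal.toReal_nonneg hω.ne (X ω + x)
    rw [smul_eq_mul]
    linarith
  rw [integral_sub hZX hΦZ, integral_sub hint (hZ.const_mul x), integral_const_mul, hZ1,
    integral_rnDeriv_smul hQP, integral_toReal hΦZm.aemeasurable hfin] at hle
  linarith

/-- Strong duality: a mean-one selection of subgradients is an optimal density. -/
lemma exists_measure_eq [IsProbabilityMeasure P]
    (hX : Measurable X) {Z : Ω → ℝ} {x : ℝ} (hZm : Measurable Z) (hZi : Integrable Z P)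
    (hZ1 : ∫ ω, Z ω ∂P = 1) (hsub : ∀ ω, IsSubgradient Φs (Z ω) (X ω + x))
    (heq : ∀ ω, 0 ≤ Z ω ∧ Φ (Z ω) ≠ ⊤ ∧ (Φ (Z ω)).toReal = Z ω * (X ω + x) - Φs (X ω + x))
    (hint : Integrable (fun ω => Φs (X ω + x)) P)
    (hint₂ : Integrable (fun ω => Φs (2 * (X ω + x))) P) :
    ∃ Q : Measure Ω, IsProbabilityMeasure Q ∧ Q ≪ P ∧
      ∫⁻ ω, Φ (Q.rnDeriv P ω).toReal ∂P ≠ ⊤ ∧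
      (∫ ω, Φs (X ω + x) ∂P) - x =
        ∫ ω, X ω ∂Q - (∫⁻ ω, Φ (Q.rnDeriv P ω).toReal ∂P).toReal := by
  have hZY : Integrable (fun ω => Z ω * (X ω + x)) P := by
    have hbound : Integrable
        (fun ω => |Φs (2 * (X ω + x)) - Φs (X ω + x)| + |Φs 0 - Φs (X ω + x)|) P :=
      (hint₂.sub hint).abs.add ((integrable_const _).sub hint).abs
    refine hbound.mono' (hZm.mul (hX.add_const x)).aestronglyMeasurable (ae_of_all _ fun ω => ?_)
    have h₁ := hsub ω (2 * (X ω + x))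
    have h₂ := hsub ω 0
    rw [Real.norm_eq_abs]
    refine abs_le.2 ⟨?_, ?_⟩
    · linarith [le_abs_self (Φs 0 - Φs (X ω + x)), abs_nonneg (Φs (2 * (X ω + x)) - Φs (X ω + x))]
    · linarith [le_abs_self (Φs (2 * (X ω + x)) - Φs (X ω + x)), abs_nonneg (Φs 0 - Φs (X ω + x))]
  have hZX : ∫ ω, Z ω * X ω ∂P = ∫ ω, Z ω * (X ω + x) ∂P - x := by
    have : ∀ ω, Z ω * X ω = Z ω * (X ω + x) - x * Z ω := fun ω => by ring
    simp_rw [this]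
    rw [integral_sub hZY (hZi.const_mul x), integral_const_mul, hZ1, mul_one]
  have hnn : ∀ ω, 0 ≤ Z ω * (X ω + x) - Φs (X ω + x) := fun ω =>
    (heq ω).2.2 ▸ ENNReal.toReal_nonneg
  have hdm : Measurable fun ω => ENNReal.ofReal (Z ω) := hZm.ennreal_ofReal
  have hrn : (P.withDensity fun ω => ENNReal.ofReal (Z ω)).rnDeriv P =ᵐ[P]
      fun ω => ENNReal.ofReal (Z ω) := Measure.rnDeriv_withDensity P hdm
  have hΦ : ∫⁻ ω, Φ ((P.withDensity fun ω => ENNReal.ofReal (Z ω)).rnDeriv P ω).toReal ∂P =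
      ENNReal.ofReal (∫ ω, (Z ω * (X ω + x) - Φs (X ω + x)) ∂P) := by
    have hi : Integrable (fun ω => Z ω * (X ω + x) - Φs (X ω + x)) P := hZY.sub hint
    rw [ofReal_integral_eq_lintegral_ofReal hi (ae_of_all _ hnn)]
    refine lintegral_congr_ae ?_
    filter_upwards [hrn] with ω hω
    rw [hω, ENNReal.toReal_ofReal (heq ω).1, ← (heq ω).2.2, ENNReal.ofReal_toReal (heq ω).2.1]
  refine ⟨P.withDensity fun ω => ENNReal.ofReal (Z ω), ⟨?_⟩, withDensity_absolutelyContinuous _ _,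
    hΦ ▸ ENNReal.ofReal_ne_top, ?_⟩
  · rw [withDensity_apply _ MeasurableSet.univ, setLIntegral_univ,
      ← ofReal_integral_eq_lintegral_ofReal hZi (ae_of_all _ fun ω => (heq ω).1), hZ1,
      ENNReal.ofReal_one]
  · rw [hΦ, ENNReal.toReal_ofReal (integral_nonneg hnn), integral_sub hZY hint,
      integral_withDensity_eq_integral_toReal_smul hdm (ae_of_all _ fun _ => ENNReal.ofReal_lt_top)]
    have : ∀ ω, (ENNReal.ofReal (Z ω)).toReal • X ω = Z ω * X ω := fun ω => by
      rw [ENNReal.toReal_ofReal (heq ω).1, smul_eq_mul]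
    simp_rw [this]
    rw [hZX]
    ring

end IsFenchelConjugate

/-- **Optimized certainty equivalent representation of divergence risk measures**
(Ben-Tal/Teboulle).  For every `X` in the Orlicz heart `H^{Φ*}`,
`ρ^Φ(X) = inf_{x ∈ ℝ} E[Φ*(X + x) − x]`, where
`ρ^Φ(X) = sup_{P̄ ∈ 𝓟_Φ} (E_{P̄}[X] − E[Φ(dP̄/dP)])`. -/
theorem divergence_risk_measure_oce_representation
    {Ω : Type*} [MeasurableSpace Ω] (P : Measure Ω) [IsProbabilityMeasure P]
    -- the probability space is atomless
    (hatomless : ∀ s : Set Ω, MeasurableSet s → 0 < P s →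
      ∃ t, t ⊆ s ∧ MeasurableSet t ∧ 0 < P t ∧ P t < P s)
    -- the divergence function Φ and its Fenchel-Legendre transform Φs
    (Φ : ℝ → ℝ≥0∞) (Φs : ℝ → ℝ)
    (hΦlsc : LowerSemicontinuous Φ)
    (hΦconv : ∀ x y a b : ℝ, 0 ≤ x → 0 ≤ y → 0 ≤ a → 0 ≤ b → a + b = 1 →
      Φ (a * x + b * y) ≤ ENNReal.ofReal a * Φ x + ENNReal.ofReal b * Φ y)
    (hΦ0 : Φ 0 ≠ ⊤)
    (hΦdom : ∃ x : ℝ, 1 < x ∧ Φ x ≠ ⊤)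
    (hΦinf : sInf (Φ '' Set.Ici (0:ℝ)) = 0)
    (hΦgrow : ∀ c : ℝ, ∀ᶠ x : ℝ in Filter.atTop, ENNReal.ofReal (c * x) ≤ Φ x)
    (hΦs : ∀ y : ℝ, IsLUB {r : ℝ | ∃ x : ℝ, 0 ≤ x ∧ Φ x ≠ ⊤ ∧ r = x * y - (Φ x).toReal} (Φs y))
    -- X belongs to the Orlicz heart H^{Φ*}
    (X : Ω → ℝ) (hXmeas : Measurable X)
    (hXheart : ∀ c : ℝ, 0 < c → Integrable (fun ω => Φs (c * |X ω|)) P) :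
    sSup {r : ℝ | ∃ Q : Measure Ω, IsProbabilityMeasure Q ∧ Q ≪ P ∧
        (∫⁻ ω, Φ ((Q.rnDeriv P ω).toReal) ∂P) ≠ ⊤ ∧
        r = (∫ ω, X ω ∂Q) - (∫⁻ ω, Φ ((Q.rnDeriv P ω).toReal) ∂P).toReal}
      = ⨅ x : ℝ, ((∫ ω, Φs (X ω + x) ∂P) - x) := by
  have h : IsFenchelConjugate Φ Φs := hΦs
  have hint : ∀ t, Integrable (fun ω => Φs (X ω + t)) P := fun t => by
    simpa using h.integrable_mul_add hΦ0 hXmeas hXheart one_pos t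
  have hint_abs : Integrable (fun ω => Φs |X ω|) P := by simpa using hXheart 1 one_pos
  have hXint : Integrable X P := by
    obtain ⟨x₀, hx₀, hΦx₀⟩ := hΦdom
    exact h.integrable_of_integrable_comp_abs hXmeas (by linarith) hΦx₀ hint_abs
  obtain ⟨x, hx⟩ := h.exists_forall_integral_le hΦ0 hΦdom hXint hint
  obtain ⟨Z, hZm, hZi, hZ1, hsub⟩ :=
    h.convexOn.exists_isSubgradient_integral_eq_one (P := P) (hXmeas.add_const x)
      (fun t => by simpa only [add_assoc] using hint (x + t))
      (fun t => by
        have := hx (x + t)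
        simp only [add_assoc]
        linarith)
  obtain ⟨Q, hQ, hQP, hQΦ, hQeq⟩ := IsFenchelConjugate.exists_measure_eq hXmeas hZm hZi hZ1
    hsub
    (fun ω => h.eq_of_isSubgradient hΦlsc hΦconv hΦ0 hΦgrow (hsub ω)) (hint x)
    (by simpa only [mul_add] using
      h.integrable_mul_add hΦ0 hXmeas hXheart two_pos (2 * x))
  have hsup : IsGreatest {r : ℝ | ∃ Q : Measure Ω, IsProbabilityMeasure Q ∧ Q ≪ P ∧
      (∫⁻ ω, Φ ((Q.rnDeriv P ω).toReal) ∂P) ≠ ⊤ ∧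
      r = (∫ ω, X ω ∂Q) - (∫⁻ ω, Φ ((Q.rnDeriv P ω).toReal) ∂P).toReal}
      ((∫ ω, Φs (X ω + x) ∂P) - x) := by
    refine ⟨⟨Q, hQ, hQP, hQΦ, hQeq⟩, ?_⟩
    rintro r ⟨Q', hQ', hQP', hQΦ', rfl⟩
    exact h.integral_sub_le hΦlsc hXmeas hint_abs hQP' hQΦ' (hint x)
  have hinf : IsLeast (range fun t : ℝ => (∫ ω, Φs (X ω + t) ∂P) - t)
      ((∫ ω, Φs (X ω + x) ∂P) - x) := by
    refine ⟨⟨x, rfl⟩, ?_⟩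
    rintro _ ⟨t, rfl⟩
    exact hx t
  exact hsup.csSup_eq.trans hinf.csInf_eq.symm
end
end

section
/- Under assumption (A1), for every n∈ℕ and every nonempty closed subset K of ℝ, the mapping X̄ₙ^K:ℝ^{dn}×Θ×K→ℝ, (z₁,…,zₙ,θ,x) ↦ (1/n)∑_{j=1}^n(Φ*(G(θ,z_j)+x)−x), is a normal integrand with respect to Θ×K and the measurable space (ℝ^{dn},B(ℝ^{dn})). -/
open MeasureTheory ProbabilityTheory Filter Set
open scoped ENNReal NNReal

noncomputable section

/-- `ℝ^n` with the Euclidean metric. -/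
abbrev Euc (n : ℕ) : Type := EuclideanSpace ℝ (Fin n)

/-- Left-continuous quantile function of a distribution function `F`. -/
def leftQuantile (F : ℝ → ℝ) (u : ℝ) : ℝ := sInf {t : ℝ | u ≤ F t}

/-- Objective function in the optimized-certainty-equivalent representation:
`x ↦ ∫_(0,1) Φ*(F⁻(u)+x) du − x`. -/
def ocePhi (Φs : ℝ → ℝ) (F : ℝ → ℝ) (x : ℝ) : ℝ :=
  (∫ u in Set.Ioo (0:ℝ) 1, Φs (leftQuantile F u + x)) - x

/-- The functional `𝓡_{ρ^Φ}` associated with the divergence risk measure. -/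
def RR (Φs : ℝ → ℝ) (F : ℝ → ℝ) : ℝ := ⨅ x : ℝ, ocePhi Φs F x

/-- `M_F`: the set of minimizers in the OCE representation. -/
def Mmin (Φs : ℝ → ℝ) (F : ℝ → ℝ) : Set ℝ :=
  {x : ℝ | ∀ y : ℝ, ocePhi Φs F x ≤ ocePhi Φs F y}

/-- Empirical distribution function `F̂_{n,θ}` based on the sample `Z_1,…,Z_n`. -/
def empDF {Ω : Type*} {m d : ℕ} (G : Euc m → Euc d → ℝ) (Z : ℕ → Ω → Euc d)
    (θ : Euc m) (n : ℕ) (ω : Ω) (t : ℝ) : ℝ :=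
  (n : ℝ)⁻¹ * ∑ j ∈ Finset.range n, (if G θ (Z j ω) ≤ t then (1:ℝ) else 0)

/-- Distribution function `F_θ` of `G(θ,Z₁)`. -/
def trueDF {Ω : Type*} [MeasurableSpace Ω] {m d : ℕ} (P : Measure Ω)
    (G : Euc m → Euc d → ℝ) (Z : ℕ → Ω → Euc d) (θ : Euc m) (t : ℝ) : ℝ :=
  (P {ω | G θ (Z 0 ω) ≤ t}).toReal

/-- Optimal value of the SAA problem: `inf_{θ∈Θ} 𝓡_{ρ^Φ}(F̂_{n,θ})`. -/
def empVal {Ω : Type*} {m d : ℕ} (Φs : ℝ → ℝ) (Θset : Set (Euc m))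
    (G : Euc m → Euc d → ℝ) (Z : ℕ → Ω → Euc d) (n : ℕ) (ω : Ω) : ℝ :=
  sInf ((fun θ => RR Φs (empDF G Z θ n ω)) '' Θset)

/-- Optimal value of the genuine problem: `inf_{θ∈Θ} 𝓡_{ρ^Φ}(F_θ)`. -/
def trueVal {Ω : Type*} [MeasurableSpace Ω] {m d : ℕ} (Φs : ℝ → ℝ) (P : Measure Ω)
    (Θset : Set (Euc m)) (G : Euc m → Euc d → ℝ) (Z : ℕ → Ω → Euc d) : ℝ :=
  sInf ((fun θ => RR Φs (trueDF P G Z θ)) '' Θset)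

/-- `L²(Q)`-distance between two functions. -/
def L2dist {α : Type*} [MeasurableSpace α] (Q : Measure α) (f g : α → ℝ) : ℝ :=
  Real.sqrt (∫ z, (f z - g z) ^ 2 ∂Q)

/-- Probability measures with finite support (the class `𝓜_fin`). -/
def IsFiniteSupportProb {α : Type*} [MeasurableSpace α] (Q : Measure α) : Prop :=
  IsProbabilityMeasure Q ∧ ∃ s : Finset α, Q ((↑s : Set α)ᶜ) = 0

/-- `N(ε,𝔽,L²(Q)) ≤ B`: the covering-number bound (centers in `𝔽`). -/
def CoverNumLE {α : Type*} [MeasurableSpace α] (Q : Measure α)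
    (𝔽 : Set (α → ℝ)) (ε B : ℝ) : Prop :=
  ∃ T : Finset (α → ℝ), (↑T : Set (α → ℝ)) ⊆ 𝔽 ∧ ((T.card : ℝ) ≤ B) ∧
    ∀ f ∈ 𝔽, ∃ g ∈ T, L2dist Q f g < ε

/-- `N_[](ε,𝔽,L²(μ)) ≤ B`: the bracketing-number bound. -/
def BracketNumLE {α : Type*} [MeasurableSpace α] (μ : Measure α)
    (𝔽 : Set (α → ℝ)) (ε B : ℝ) : Prop :=
  ∃ Brk : Finset ((α → ℝ) × (α → ℝ)), ((Brk.card : ℝ) ≤ B) ∧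
    (∀ ψ ∈ Brk, MeasureTheory.Integrable (fun z => (ψ.1 z) ^ 2) μ ∧
      MeasureTheory.Integrable (fun z => (ψ.2 z) ^ 2) μ ∧ L2dist μ ψ.1 ψ.2 < ε) ∧
    ∀ f ∈ 𝔽, ∃ ψ ∈ Brk, ∀ z, ψ.1 z ≤ f z ∧ f z ≤ ψ.2 z

/-- A sequence of sets is jointly separable if its members can be enlarged to measurable sets with
empty intersection. -/
def JointlySeparable {α : Type*} [MeasurableSpace α] (s : ℕ → Set α) : Prop :=
  ∃ u : ℕ → Set α, (∀ n, s n ⊆ u n) ∧ (∀ n, MeasurableSet (u n)) ∧ ⋂ n, u n = ∅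

theorem JointlySeparable.of_subset_iUnion {α : Type*} [MeasurableSpace α] {s : ℕ → Set α} (k : ℕ)
    {t : ℕ → ℕ → Set α} (hk : s k ⊆ ⋃ i, t i k) (hne : ∀ i n, n ≠ k → s n ⊆ t i n)
    (ht : ∀ i, JointlySeparable (t i)) : JointlySeparable s := by
  choose u hsub hmeas hemp using ht
  refine ⟨fun n => if n = k then ⋃ i, u i n else ⋂ i, u i n, fun n => ?_, fun n => ?_, ?_⟩
  · by_cases h : n = k
    · subst h
      simpa using hk.trans (iUnion_mono fun i => hsub i n)
    · simpa [h] using fun i => (hne i n h).trans (hsub i n)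
  · dsimp only
    split_ifs
    · exact MeasurableSet.iUnion fun i => hmeas i n
    · exact MeasurableSet.iInter fun i => hmeas i n
  · refine eq_empty_iff_forall_notMem.2 fun x hx => ?_
    rw [mem_iInter] at hx
    have h1 := hx k
    simp only [if_true, mem_iUnion] at h1
    obtain ⟨i, hi⟩ := h1
    refine eq_empty_iff_forall_notMem.1 (hemp i) x (mem_iInter.2 fun n => ?_)
    by_cases h : n = k
    · exact h ▸ hi
    · have := hx n
      simp only [h, if_false, mem_iInter] at this
      exact this i

theorem exists_forall_agree_imp_mem {α : Type*} [TopologicalSpace α] {f : (ℕ → ℕ) → α}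
    (hf : Continuous f) (y : ℕ → ℕ) {U : Set α} (hU : IsOpen U) (hy : f y ∈ U) :
    ∃ N, ∀ x : ℕ → ℕ, (∀ i < N, x i = y i) → f x ∈ U := by
  obtain ⟨_, ⟨x', N, rfl⟩, hyx, hsub⟩ :=
    (PiNat.isTopologicalBasis_cylinders (fun _ : ℕ => ℕ)).exists_subset_of_mem_open
      (show y ∈ f ⁻¹' U from hy) (hU.preimage hf)
  refine ⟨N, fun x hx => hsub ?_⟩
  rw [← PiNat.mem_cylinder_iff_eq.1 hyx]
  exact PiNat.mem_cylinder_iff.2 hx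

/-- **Novikov's separation theorem** for continuous images of the Baire space. -/
theorem jointlySeparable_range {α : Type*} [TopologicalSpace α] [T2Space α] [MeasurableSpace α]
    [OpensMeasurableSpace α] {f : ℕ → (ℕ → ℕ) → α} (hf : ∀ n, Continuous (f n))
    (h : ⋂ n, range (f n) = ∅) : JointlySeparable fun n => range (f n) := by
  by_contra hsep
  -- a sequence `w` encodes one point of the Baire space for every `n`
  let C : ℕ → (ℕ → ℕ) → ℕ → Set (ℕ → ℕ) := fun e w n =>
    {x | ∀ i, Nat.pair n i < e → x i = w (Nat.pair n i)}
  let P : ℕ → (ℕ → ℕ) → Prop := fun e w => ¬ JointlySeparable fun n => f n '' C e w n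
  have hP0 : P 0 0 := by simpa [P, C] using hsep
  have hstep : ∀ e w, P e w → ∃ j, P (e + 1) (Function.update w e j) := by
    intro e w
    contrapose!
    intro hj
    simp only [P, not_not] at hj ⊢
    refine JointlySeparable.of_subset_iUnion (Nat.unpair e).1 ?_ ?_ hj
    · rintro _ ⟨x, hx, rfl⟩
      refine mem_iUnion.2 ⟨x (Nat.unpair e).2, x, fun i hi => ?_, rfl⟩
      rcases (Nat.lt_succ_iff_lt_or_eq.1 hi) with hlt | heq
      · rw [Function.update_of_ne hlt.ne]
        exact hx i hlt
      · have : i = (Nat.unpair e).2 := by rw [← heq]; simp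
        rw [heq, Function.update_self, this]
    · rintro j n hn _ ⟨x, hx, rfl⟩
      refine ⟨x, fun i hi => ?_, rfl⟩
      rcases (Nat.lt_succ_iff_lt_or_eq.1 hi) with hlt | heq
      · rw [Function.update_of_ne hlt.ne]
        exact hx i hlt
      · exact absurd (by rw [← heq]; simp) hn
  choose! J hJ using hstep
  let W : ℕ → ℕ → ℕ := fun e => Nat.rec 0 (fun e w => Function.update w e (J e w)) e
  have hWsucc : ∀ e, W (e + 1) = Function.update (W e) e (J e (W e)) := fun _ => rfl
  have hPW : ∀ e, P e (W e) := by
    intro e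
    induction e with
    | zero => exact hP0
    | succ e ih => rw [hWsucc]; exact hJ e _ ih
  let w : ℕ → ℕ := fun e => W (e + 1) e
  have hWw : ∀ e i, i < e → W e i = w i := by
    intro e i hi
    induction e, hi using Nat.le_induction with
    | base => rfl
    | succ e he ih =>
      rw [hWsucc, Function.update_of_ne (by omega)]
      exact ih
  let y : ℕ → ℕ → ℕ := fun n i => w (Nat.pair n i)
  obtain ⟨n, hn⟩ : ∃ n, f n (y n) ≠ f 0 (y 0) := by
    by_contra! hall
    exact h.subset (mem_iInter.2 fun n => ⟨y n, hall n⟩)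
  obtain ⟨U, V, hU, hV, hnU, hV0, hUV⟩ := t2_separation hn
  obtain ⟨N, hN⟩ := exists_forall_agree_imp_mem (hf n) (y n) hU hnU
  obtain ⟨M, hM⟩ := exists_forall_agree_imp_mem (hf 0) (y 0) hV hV0
  have hn0 : n ≠ 0 := by rintro rfl; exact hn rfl
  let e := Nat.pair n N + Nat.pair 0 M + 1
  refine hPW e ⟨fun k => if k = n then U else if k = 0 then V else univ, ?_, ?_, ?_⟩
  · intro k
    dsimp only
    split_ifs with h1 h2
    · subst h1
      rintro _ ⟨x, hx, rfl⟩
      refine hN x fun i hi => ?_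
      have hlt : Nat.pair k i < e := by
        have := Nat.pair_lt_pair_right k hi
        omega
      rw [hx i hlt, hWw _ _ hlt]
    · subst h2
      rintro _ ⟨x, hx, rfl⟩
      refine hM x fun i hi => ?_
      have hlt : Nat.pair 0 i < e := by
        have := Nat.pair_lt_pair_right 0 hi
        omega
      rw [hx i hlt, hWw _ _ hlt]
    · exact subset_univ _
  · intro k
    dsimp only
    split_ifs
    exacts [hU.measurableSet, hV.measurableSet, MeasurableSet.univ]
  · refine eq_empty_iff_forall_notMem.2 fun x hx => ?_
    rw [mem_iInter] at hx
    have h1 := hx n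
    have h2 := hx 0
    simp only [if_true] at h1
    rw [if_neg hn0.symm, if_pos rfl] at h2
    exact disjoint_left.1 hUV h1 h2

/-- **Novikov's separation theorem**: a sequence of analytic sets with empty intersection can be
enlarged to a sequence of Borel sets with empty intersection. -/
theorem AnalyticSet.jointlySeparable {α : Type*} [TopologicalSpace α] [T2Space α]
    [MeasurableSpace α] [OpensMeasurableSpace α] {s : ℕ → Set α} (hs : ∀ n, AnalyticSet (s n))
    (h : ⋂ n, s n = ∅) : JointlySeparable s := by
  by_cases hne : ∃ n, s n = ∅
  · obtain ⟨n, hn⟩ := hne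
    refine ⟨fun k => if k = n then ∅ else univ, fun k => ?_, fun k => ?_, ?_⟩
    · dsimp only
      split_ifs with hk
      · rw [hk, hn]
      · exact subset_univ _
    · dsimp only
      split_ifs
      exacts [MeasurableSet.empty, MeasurableSet.univ]
    · exact eq_empty_iff_forall_notMem.2 fun x hx => by simpa using mem_iInter.1 hx n
  · push Not at hne
    have : ∀ n, ∃ f : (ℕ → ℕ) → α, Continuous f ∧ range f = s n := by
      intro n
      have := hs n
      rw [AnalyticSet] at this
      exact this.resolve_left (hne n).ne_empty
    choose f hf hfs using this
    obtain rfl : (fun n => range (f n)) = s := funext hfs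
    exact jointlySeparable_range hf h

/-- **Kunugui–Novikov theorem**: a Borel set with open sections is a countable union of
rectangles `B n ×ˢ V n` with `B n` Borel and `V n` from a given countable basis. -/
theorem exists_measurable_rectangles_of_isOpen_sections {Z X : Type*}
    [TopologicalSpace Z] [PolishSpace Z] [MeasurableSpace Z] [BorelSpace Z]
    [TopologicalSpace X] [PolishSpace X] [MeasurableSpace X] [BorelSpace X]
    {O : Set (Z × X)} (hO : MeasurableSet O) (hsec : ∀ z, IsOpen {x | (z, x) ∈ O})
    {V : ℕ → Set X} (hV : TopologicalSpace.IsTopologicalBasis (range V)) :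
    ∃ B : ℕ → Set Z, (∀ n, MeasurableSet (B n)) ∧ O = ⋃ n, B n ×ˢ V n := by
  have hVo : ∀ n, IsOpen (V n) := fun n => hV.isOpen ⟨n, rfl⟩
  -- `T n` is the set of points whose section does not contain `V n`
  let T : ℕ → Set Z := fun n => Prod.fst '' (Oᶜ ∩ Prod.snd ⁻¹' V n)
  have hT : ∀ n, AnalyticSet (T n) := fun n =>
    (hO.compl.inter ((hVo n).measurableSet.preimage measurable_snd)).analyticSet_image
      measurable_fst
  have hTmem : ∀ n z, z ∉ T n → ∀ x ∈ V n, (z, x) ∈ O := by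
    intro n z hz x hx
    by_contra hzx
    exact hz ⟨(z, x), ⟨hzx, hx⟩, rfl⟩
  let S : ℕ → Set (Z × X) := fun n =>
    ⋂ b : Bool, cond b O (⋃ c : Bool, cond c (Prod.snd ⁻¹' (V n)ᶜ) (Prod.fst ⁻¹' T n))
  have hSmem : ∀ n p, p ∈ S n ↔ (p.2 ∉ V n ∨ p.1 ∈ T n) ∧ p ∈ O := by
    intro n p
    simp [S, or_comm]
  have hS : ∀ n, AnalyticSet (S n) := by
    intro n
    refine AnalyticSet.iInter fun b => ?_
    cases b
    · refine AnalyticSet.iUnion fun c => ?_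
      cases c
      · exact (hT n).preimage continuous_fst
      · exact ((hVo n).measurableSet.compl.preimage measurable_snd).analyticSet
    · exact hO.analyticSet
  have hSe : ⋂ n, S n = ∅ := by
    refine eq_empty_iff_forall_notMem.2 fun p hp => ?_
    rw [mem_iInter] at hp
    have hpO : p ∈ O := ((hSmem 0 p).1 (hp 0)).2
    obtain ⟨_, ⟨n, rfl⟩, hpn, hsub⟩ := hV.exists_subset_of_mem_open
      (show p.2 ∈ {x | (p.1, x) ∈ O} from hpO) (hsec p.1)
    rcases ((hSmem n p).1 (hp n)).1 with h1 | ⟨q, ⟨hq, hqV⟩, hqp⟩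
    · exact h1 hpn
    · apply hq
      have := hsub hqV
      rw [← hqp] at this
      exact this
  obtain ⟨E, hSE, hE, hEe⟩ := AnalyticSet.jointlySeparable hS hSe
  have hD : ∀ n, ∀ p ∈ O \ E n, p.2 ∈ V n ∧ p.1 ∉ T n := by
    intro n p hp
    by_contra hcon
    refine hp.2 (hSE n ((hSmem n p).2 ⟨?_, hp.1⟩))
    tauto
  have hsepar : ∀ n, MeasurablySeparable (Prod.fst '' (O \ E n)) (T n) := by
    intro n
    refine AnalyticSet.measurablySeparable
      ((hO.diff (hE n)).analyticSet_image measurable_fst) (hT n) ?_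
    rw [disjoint_left]
    rintro _ ⟨p, hp, rfl⟩
    exact (hD n p hp).2
  choose B hDB hTB hB using hsepar
  refine ⟨B, hB, Subset.antisymm (fun p hp => ?_) (iUnion_subset fun n p hp => ?_)⟩
  · have : p ∉ ⋂ n, E n := by simp [hEe]
    rw [mem_iInter, not_forall] at this
    obtain ⟨n, hn⟩ := this
    exact mem_iUnion.2 ⟨n, hDB n ⟨p, ⟨hp, hn⟩, rfl⟩, (hD n p ⟨hp, hn⟩).1⟩
  · exact hTmem n p.1 (fun hT => disjoint_left.1 (hTB n) hT hp.1) p.2 hp.2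

/-- **Novikov's projection theorem**: if `A` is Borel with closed sections and `K` is compact, the
set of points whose section meets `K` is Borel. -/
theorem measurableSet_exists_mem_compact {Z X : Type*}
    [TopologicalSpace Z] [PolishSpace Z] [MeasurableSpace Z] [BorelSpace Z]
    [TopologicalSpace X] [PolishSpace X] [MeasurableSpace X] [BorelSpace X]
    {A : Set (Z × X)} (hA : MeasurableSet A) (hsec : ∀ z, IsClosed {x | (z, x) ∈ A})
    {K : Set X} (hK : IsCompact K) : MeasurableSet {z | ∃ x ∈ K, (z, x) ∈ A} := by
  obtain ⟨V, hVeq⟩ := ((TopologicalSpace.countable_countableBasis X).insert ∅).exists_eq_range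
    (insert_nonempty _ _)
  have hV : TopologicalSpace.IsTopologicalBasis (range V) :=
    hVeq ▸ (TopologicalSpace.isBasis_countableBasis X).insert_empty
  obtain ⟨B, hB, hAB⟩ := exists_measurable_rectangles_of_isOpen_sections hA.compl
    (fun z => (hsec z).isOpen_compl) hV
  have key : {z | ∃ x ∈ K, (z, x) ∈ A}ᶜ =
      ⋃ F : {F : Finset ℕ // K ⊆ ⋃ i ∈ F, V i}, ⋂ i ∈ F.1, B i := by
    ext z
    simp only [mem_compl_iff, mem_ofPred_eq, not_exists, not_and, mem_iUnion, mem_iInter]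
    constructor
    · intro hz
      obtain ⟨F, hF⟩ := hK.elim_finite_subcover (fun i : {i // z ∈ B i} => V i)
        (fun i => hV.isOpen ⟨i, rfl⟩) (fun x hx => by
          have : (z, x) ∈ Aᶜ := hz x hx
          rw [hAB, mem_iUnion] at this
          obtain ⟨i, hi⟩ := this
          exact mem_iUnion.2 ⟨⟨i, hi.1⟩, hi.2⟩)
      refine ⟨⟨F.map (Function.Embedding.subtype _), fun x hx => ?_⟩, fun i hi => ?_⟩
      · obtain ⟨i, hi, hxi⟩ := mem_iUnion₂.1 (hF hx)
        exact mem_iUnion₂.2 ⟨i, Finset.mem_map.2 ⟨i, hi, rfl⟩, hxi⟩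
      · obtain ⟨j, -, rfl⟩ := Finset.mem_map.1 hi
        exact j.2
    · rintro ⟨⟨F, hF⟩, hz⟩ x hx
      obtain ⟨i, hi, hxi⟩ := mem_iUnion₂.1 (hF hx)
      have : (z, x) ∈ Aᶜ := hAB ▸ mem_iUnion.2 ⟨i, hz i hi, hxi⟩
      exact this
  rw [← MeasurableSet.compl_iff, key]
  exact MeasurableSet.iUnion fun F => MeasurableSet.biInter F.1.countable_toSet fun i _ => hB i

/-- In a locally compact Polish space, the set of points at which the sections of a Borel set with
closed sections meet a given open set is Borel. -/
theorem measurableSet_exists_mem_isOpen {Z X : Type*}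
    [TopologicalSpace Z] [PolishSpace Z] [MeasurableSpace Z] [BorelSpace Z]
    [TopologicalSpace X] [PolishSpace X] [LocallyCompactSpace X] [MeasurableSpace X] [BorelSpace X]
    {A : Set (Z × X)} (hA : MeasurableSet A) (hsec : ∀ z, IsClosed {x | (z, x) ∈ A})
    {U : Set X} (hU : IsOpen U) : MeasurableSet {z | ∃ x ∈ U, (z, x) ∈ A} := by
  have : LocallyCompactSpace U := hU.locallyCompactSpace
  obtain ⟨K, hK, hKU⟩ := isSigmaCompact_iff_sigmaCompactSpace.2 (inferInstance : SigmaCompactSpace U)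
  have : {z | ∃ x ∈ U, (z, x) ∈ A} = ⋃ n, {z | ∃ x ∈ K n, (z, x) ∈ A} := by
    ext z
    simp only [← hKU, mem_ofPred_eq, mem_iUnion]
    tauto
  rw [this]
  exact MeasurableSet.iUnion fun n => measurableSet_exists_mem_compact hA hsec (hK n)

theorem monotone_of_isLUB_conjugate {Φ : ℝ → ℝ≥0∞} {Φs : ℝ → ℝ}
    (h : ∀ y : ℝ, IsLUB {r : ℝ | ∃ x : ℝ, 0 ≤ x ∧ Φ x ≠ ⊤ ∧ r = x * y - (Φ x).toReal} (Φs y)) :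
    Monotone Φs := by
  intro y y' hy
  refine (h y).2 ?_
  rintro _ ⟨x, hx, hΦx, rfl⟩
  have h1 := (h y').1 ⟨x, hx, hΦx, rfl⟩
  have h2 := mul_le_mul_of_nonneg_left hy hx
  linarith

theorem continuous_of_isLUB_conjugate {Φ : ℝ → ℝ≥0∞} {Φs : ℝ → ℝ}
    (h : ∀ y : ℝ, IsLUB {r : ℝ | ∃ x : ℝ, 0 ≤ x ∧ Φ x ≠ ⊤ ∧ r = x * y - (Φ x).toReal} (Φs y)) :
    Continuous Φs := by
  have hconv : ConvexOn ℝ univ Φs := by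
    refine ⟨convex_univ, fun y _ y' _ a b ha hb hab => (h _).2 ?_⟩
    rintro _ ⟨x, hx, hΦx, rfl⟩
    have h1 := mul_le_mul_of_nonneg_left ((h y).1 ⟨x, hx, hΦx, rfl⟩) ha
    have h2 := mul_le_mul_of_nonneg_left ((h y').1 ⟨x, hx, hΦx, rfl⟩) hb
    simp only [smul_eq_mul]
    have h3 : (Φ x).toReal = a * (Φ x).toReal + b * (Φ x).toReal := by rw [← add_mul, hab, one_mul]
    nlinarith
  exact continuousOn_univ.1 (hconv.continuousOn isOpen_univ)

/-- **The SAA objectives are normal integrands** (Lemma `normal integrands`).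
Under (A1), for every `n` and every nonempty closed `K ⊆ ℝ`, the mapping
`X̄ₙ^K(z₁,…,zₙ,θ,x) = (1/n)∑_j (Φ*(G(θ,z_j)+x) − x)` is a normal integrand with
respect to `Θ × K` and `(ℝ^{dn}, 𝓑(ℝ^{dn}))`. -/
theorem saa_objective_normal_integrand
    {m d : ℕ} (Θset : Set (Euc m)) (hΘne : Θset.Nonempty) (hΘcpt : IsCompact Θset)
    (G : Euc m → Euc d → ℝ)
    -- Φ and its Fenchel-Legendre transform
    (Φ : ℝ → ℝ≥0∞) (Φs : ℝ → ℝ)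
    (hΦlsc : LowerSemicontinuous Φ)
    (hΦconv : ∀ x y a b : ℝ, 0 ≤ x → 0 ≤ y → 0 ≤ a → 0 ≤ b → a + b = 1 →
      Φ (a * x + b * y) ≤ ENNReal.ofReal a * Φ x + ENNReal.ofReal b * Φ y)
    (hΦ0 : Φ 0 ≠ ⊤)
    (hΦdom : ∃ x : ℝ, 1 < x ∧ Φ x ≠ ⊤)
    (hΦinf : sInf (Φ '' Set.Ici (0:ℝ)) = 0)
    (hΦgrow : ∀ c : ℝ, ∀ᶠ x : ℝ in Filter.atTop, ENNReal.ofReal (c * x) ≤ Φ x)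
    (hΦs : ∀ y : ℝ, IsLUB {r : ℝ | ∃ x : ℝ, 0 ≤ x ∧ Φ x ≠ ⊤ ∧ r = x * y - (Φ x).toReal} (Φs y))
    -- (A 1)
    (hA1meas : Measurable fun p : {θ : Euc m // θ ∈ Θset} × Euc d => G p.1 p.2)
    (hA1lsc : ∀ z : Euc d, LowerSemicontinuousOn (fun θ => G θ z) Θset)
    (n : ℕ) (hn : 0 < n)
    (Kset : Set ℝ) (hKne : Kset.Nonempty) (hKcl : IsClosed Kset) :
    -- lower semicontinuity in (θ,x) ∈ Θ × K for every (z₁,…,zₙ)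
    (∀ zs : Fin n → Euc d,
      LowerSemicontinuous (fun p : {q : Euc m × ℝ // q.1 ∈ Θset ∧ q.2 ∈ Kset} =>
        (n : ℝ)⁻¹ * ∑ j : Fin n, (Φs (G (p : Euc m × ℝ).1 (zs j) + (p : Euc m × ℝ).2) -
          (p : Euc m × ℝ).2))) ∧
    -- measurability of the epigraph multifunction
    (∀ U : Set ({q : Euc m × ℝ // q.1 ∈ Θset ∧ q.2 ∈ Kset} × ℝ), IsOpen U →
      MeasurableSet {zs : Fin n → Euc d | ∃ p ∈ U,
        (n : ℝ)⁻¹ * ∑ j : Fin n, (Φs (G (p.1 : Euc m × ℝ).1 (zs j) +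
          (p.1 : Euc m × ℝ).2) - (p.1 : Euc m × ℝ).2) ≤ p.2}) := by
  have hmono : Monotone Φs := monotone_of_isLUB_conjugate hΦs
  have hcont : Continuous Φs := continuous_of_isLUB_conjugate hΦs
  have hlsc : ∀ zs : Fin n → Euc d,
      LowerSemicontinuous (fun p : {q : Euc m × ℝ // q.1 ∈ Θset ∧ q.2 ∈ Kset} =>
        (n : ℝ)⁻¹ * ∑ j : Fin n, (Φs (G (p : Euc m × ℝ).1 (zs j) + (p : Euc m × ℝ).2) -
          (p : Euc m × ℝ).2)) := by
    intro zs
    have hG : ∀ j, LowerSemicontinuous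
        (fun p : {q : Euc m × ℝ // q.1 ∈ Θset ∧ q.2 ∈ Kset} => G p.1.1 (zs j)) := fun j =>
      (lowerSemicontinuous_restrict_iff.2 (hA1lsc (zs j))).comp
        (g := fun p : {q : Euc m × ℝ // q.1 ∈ Θset ∧ q.2 ∈ Kset} => (⟨p.1.1, p.2.1⟩ : Θset))
        (by fun_prop)
    have hx : Continuous
        (fun p : {q : Euc m × ℝ // q.1 ∈ Θset ∧ q.2 ∈ Kset} => p.1.2) := by fun_prop
    refine (continuous_const_mul (n : ℝ)⁻¹).comp_lowerSemicontinuous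
      (lowerSemicontinuous_sum fun j _ => ?_)
      (monotone_mul_left_of_nonneg (by positivity))
    simp only [sub_eq_add_neg]
    exact (hcont.comp_lowerSemicontinuous ((hG j).add hx.lowerSemicontinuous) hmono).add
      hx.neg.lowerSemicontinuous
  refine ⟨hlsc, fun U hU => ?_⟩
  have hcl : IsClosed {q : Euc m × ℝ | q.1 ∈ Θset ∧ q.2 ∈ Kset} :=
    hΘcpt.isClosed.prod hKcl
  have : PolishSpace {q : Euc m × ℝ // q.1 ∈ Θset ∧ q.2 ∈ Kset} := hcl.polishSpace
  have : LocallyCompactSpace {q : Euc m × ℝ // q.1 ∈ Θset ∧ q.2 ∈ Kset} :=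
    hcl.isClosedEmbedding_subtypeVal.locallyCompactSpace
  refine measurableSet_exists_mem_isOpen
    (A := {a : (Fin n → Euc d) × ({q : Euc m × ℝ // q.1 ∈ Θset ∧ q.2 ∈ Kset} × ℝ) |
      (n : ℝ)⁻¹ * ∑ j : Fin n, (Φs (G a.2.1.1.1 (a.1 j) + a.2.1.1.2) - a.2.1.1.2) ≤ a.2.2})
    ?_ (fun zs => (hlsc zs).isClosed_epigraph) hU
  have hGm : ∀ j : Fin n, Measurable
      (fun a : (Fin n → Euc d) × ({q : Euc m × ℝ // q.1 ∈ Θset ∧ q.2 ∈ Kset} × ℝ) =>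
        G a.2.1.1.1 (a.1 j)) := fun j =>
    hA1meas.comp (f := fun a : (Fin n → Euc d) ×
      ({q : Euc m × ℝ // q.1 ∈ Θset ∧ q.2 ∈ Kset} × ℝ) =>
        ((⟨a.2.1.1.1, a.2.1.2.1⟩ : {θ : Euc m // θ ∈ Θset}), a.1 j)) (by fun_prop)
  have hΦm : Measurable Φs := hcont.measurable
  exact measurableSet_le (measurable_const.mul (Finset.measurable_sum _ fun j _ =>
    (hΦm.comp ((hGm j).add (by fun_prop))).sub (by fun_prop))) (by fun_prop)
end
end

section
/- The function of certainty equivalents φ_{Φ*} satisfies: 1) for every F∈𝔽_{Φ*}, the mapping x ↦ φ_{Φ*}(F,x) is convex, and its set of minimizers argmin(φ_{Φ*}(F,·)) is a nonempty compact interval in ℝ; 2) for every F∈𝔽_{Φ*} and every x∈ℝ, the left- and right-sided derivatives of φ_{Φ*}(F,·) at x are given by φ_{Φ*}(F,·)'₋(x) = ∫₀¹ Φ*'₋(F⁻(u)+x) du − 1 and φ_{Φ*}(F,·)'₊(x) = ∫₀¹ Φ*'₊(F⁻(u)+x) du − 1, where Φ*'₋ and Φ*'₊ denote the left- and right-sided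 derivatives of Φ*. -/
open MeasureTheory ProbabilityTheory Filter Set
open scoped ENNReal NNReal

noncomputable section

open scoped Topology

/-- A pointwise supremum of affine functions is convex. -/
theorem convexOn_of_isLUB_affine {S : Set (ℝ × ℝ)} {f : ℝ → ℝ}
    (hf : ∀ y, IsLUB {r : ℝ | ∃ p ∈ S, r = p.1 * y - p.2} (f y)) :
    ConvexOn ℝ Set.univ f := by
  refine ⟨convex_univ, ?_⟩
  intro y _ z _ a b ha hb hab
  refine (hf _).2 ?_
  rintro r ⟨p, hp, rfl⟩
  have h1 := mul_le_mul_of_nonneg_left ((hf y).1 ⟨p, hp, rfl⟩) ha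
  have h2 := mul_le_mul_of_nonneg_left ((hf z).1 ⟨p, hp, rfl⟩) hb
  simp only [smul_eq_mul]
  have h3 : p.1 * (a * y + b * z) - p.2 = a * (p.1 * y - p.2) + b * (p.1 * z - p.2) := by
    linear_combination p.2 * hab
  linarith

/-- A convex real function is continuous. -/
theorem continuous_of_convexOn_univ {f : ℝ → ℝ} (hf : ConvexOn ℝ Set.univ f) : Continuous f :=
  continuousOn_univ.1 (hf.continuousOn isOpen_univ)

/-- The difference quotients of a convex function with increments in `[-1, 1]` are controlled by
the increments of length one. -/
theorem abs_slope_le_of_convexOn {f : ℝ → ℝ} (hf : ConvexOn ℝ Set.univ f) {y h : ℝ}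
    (h0 : h ≠ 0) (hh : |h| ≤ 1) :
    |h⁻¹ * (f (y + h) - f y)| ≤ |f (y + 1) - f y| + |f (y - 1) - f y| := by
  have key : ∀ s t : ℝ, 0 ≤ t → t ≤ 1 →
      f (y + s * t) - f y ≤ t * (f (y + s) - f y) := by
    intro s t ht0 ht1
    have := hf.2 (mem_univ (y + s)) (mem_univ y) ht0 (sub_nonneg.2 ht1) (by ring)
    simp only [smul_eq_mul] at this
    rw [show t * (y + s) + (1 - t) * y = y + s * t by ring] at this
    linarith
  have mid : ∀ t : ℝ, 2 * f y ≤ f (y + t) + f (y - t) := by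
    intro t
    have := hf.2 (mem_univ (y + t)) (mem_univ (y - t)) (by norm_num : (0:ℝ) ≤ 1/2)
      (by norm_num : (0:ℝ) ≤ 1/2) (by norm_num)
    simp only [smul_eq_mul] at this
    rw [show 1 / 2 * (y + t) + 1 / 2 * (y - t) = y by ring] at this
    linarith
  have habs : 0 < |h| := abs_pos.2 h0
  rw [abs_mul, abs_inv, inv_mul_le_iff₀ habs]
  have k1 := key 1 |h| habs.le hh
  have k2 := key (-1) |h| habs.le hh
  have m := mid |h|
  rw [one_mul] at k1
  rw [show y + -1 * |h| = y - |h| by ring, show y + -1 = y - 1 by ring] at k2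
  have a1 := mul_le_mul_of_nonneg_left (le_abs_self (f (y + 1) - f y)) habs.le
  have a2 := mul_le_mul_of_nonneg_left (le_abs_self (f (y - 1) - f y)) habs.le
  have a3 := mul_nonneg habs.le (abs_nonneg (f (y + 1) - f y))
  have a4 := mul_nonneg habs.le (abs_nonneg (f (y - 1) - f y))
  rw [abs_le, mul_add]
  rcases abs_choice h with e | e
  · have e' : f (y + h) = f (y + |h|) := by rw [e]
    constructor <;> linarith
  · have e' : f (y + h) = f (y - |h|) := by rw [e, sub_neg_eq_add]
    constructor <;> linarith

/-- One-sided differentiation under the integral sign for translates of a convex function. -/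
theorem hasDerivWithinAt_integral_of_convexOn {α : Type*} [MeasurableSpace α] {μ : Measure α}
    {f f' : ℝ → ℝ} {q : α → ℝ} (hf : ConvexOn ℝ Set.univ f)
    (hint : ∀ x, Integrable (fun u => f (q u + x)) μ) {T : ℝ → Set ℝ}
    (hT : ∀ y h z, y + h ∈ T y ↔ z + h ∈ T z)
    (hf' : ∀ y, HasDerivWithinAt f (f' y) (T y) y) (x : ℝ) :
    HasDerivWithinAt (fun y => ∫ u, f (q u + y) ∂μ) (∫ u, f' (q u + x) ∂μ) (T x) x := by
  rw [hasDerivWithinAt_iff_tendsto_slope]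
  have hmeas : ∀ y, AEStronglyMeasurable (fun u => slope (fun z => f (q u + z)) x y) μ := by
    intro y
    simp only [slope_def_module]
    exact (((hint y).sub (hint x)).smul (y - x)⁻¹).1
  have heq : slope (fun y => ∫ u, f (q u + y) ∂μ) x
      = fun y => ∫ u, slope (fun z => f (q u + z)) x y ∂μ := by
    ext y
    simp only [slope_def_module]
    rw [integral_smul, integral_sub (hint y) (hint x)]
  rw [heq]
  refine tendsto_integral_filter_of_dominated_convergence
    (fun u => |f (q u + (x + 1)) - f (q u + x)| + |f (q u + (x - 1)) - f (q u + x)|)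
    (Eventually.of_forall hmeas) ?_ ?_ ?_
  · have h1 : ∀ᶠ y in 𝓝[T x \ {x}] x, |y - x| ≤ 1 := by
      refine nhdsWithin_le_nhds ?_
      filter_upwards [Metric.closedBall_mem_nhds x one_pos] with y hy
      simpa [Real.dist_eq] using hy
    filter_upwards [h1, self_mem_nhdsWithin] with y hy1 hy2
    refine Eventually.of_forall fun u => ?_
    have := abs_slope_le_of_convexOn hf (y := q u + x) (h := y - x)
      (sub_ne_zero.2 hy2.2) hy1
    simpa [slope_def_module, add_assoc, add_sub_assoc] using this
  · exact ((hint (x + 1)).sub (hint x)).abs.add ((hint (x - 1)).sub (hint x)).abs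
  · refine Eventually.of_forall fun u => ?_
    rw [← hasDerivWithinAt_iff_tendsto_slope]
    have h1 : HasDerivWithinAt (fun z => q u + z) 1 (T x) x :=
      ((hasDerivAt_id x).const_add (q u)).hasDerivWithinAt
    have h2 : MapsTo (fun z => q u + z) (T x) (T (q u + x)) := by
      intro z hz
      have := (hT x (z - x) (q u + x)).1 (by simpa using hz)
      simpa [add_assoc] using this
    simpa [Function.comp_def] using (hf' (q u + x)).comp x h1 h2

/-- The minimizers of a coercive convex function on the line form a nonempty compact interval. -/
theorem exists_argmin_eq_Icc {f : ℝ → ℝ} (hf : ConvexOn ℝ Set.univ f)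
    (htop : Tendsto f atTop atTop) (hbot : Tendsto f atBot atTop) :
    ∃ a b : ℝ, a ≤ b ∧ {x : ℝ | ∀ y, f x ≤ f y} = Set.Icc a b := by
  have hc := continuous_of_convexOn_univ hf
  have hlim : Tendsto f (cocompact ℝ) atTop := by
    rw [cocompact_eq_atBot_atTop]
    exact hbot.sup htop
  obtain ⟨x₀, hx₀⟩ := hc.exists_forall_le hlim
  have hset : {x : ℝ | ∀ y, f x ≤ f y} = {x | f x ≤ f x₀} := by
    ext x
    exact ⟨fun h => h x₀, fun h y => le_trans h (hx₀ y)⟩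
  have hcompact : IsCompact {x | f x ≤ f x₀} := by
    obtain ⟨K, hK, hsub⟩ := mem_cocompact.1 (hlim.eventually_gt_atTop (f x₀))
    refine hK.of_isClosed_subset (isClosed_le hc continuous_const) fun x hx => ?_
    by_contra hxK
    exact (show f x ≤ f x₀ from hx).not_gt (hsub hxK)
  have hconn : IsConnected {x | f x ≤ f x₀} := by
    refine ⟨⟨x₀, le_refl (f x₀)⟩, ?_⟩
    have := (hf.convex_le (f x₀)).isPreconnected
    simpa using this
  have hIcc := eq_Icc_of_connected_compact hconn hcompact
  refine ⟨_, _, ?_, hset.trans hIcc⟩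
  have := hconn.1
  rw [hIcc] at this
  exact Set.nonempty_Icc.1 this

/-- The left-continuous quantile function is a lower adjoint of the distribution function. -/
theorem leftQuantile_cdf_le_iff (ν : Measure ℝ) [IsProbabilityMeasure ν] {u : ℝ}
    (hu : u ∈ Set.Ioo (0:ℝ) 1) (t : ℝ) : leftQuantile (cdf ν) u ≤ t ↔ u ≤ cdf ν t := by
  have hbdd : BddBelow {t : ℝ | u ≤ cdf ν t} := by
    obtain ⟨m, hm⟩ := ((tendsto_cdf_atBot ν).eventually_lt_const hu.1).exists
    refine ⟨m, fun s hs => ?_⟩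
    by_contra! hlt
    exact absurd (hs.trans (monotone_cdf ν hlt.le)) (not_le.2 hm)
  have hne : {t : ℝ | u ≤ cdf ν t}.Nonempty := by
    obtain ⟨m, hm⟩ := ((tendsto_cdf_atTop ν).eventually_const_lt hu.2).exists
    exact ⟨m, hm.le⟩
  refine ⟨fun h => ?_, fun h => csInf_le hbdd h⟩
  have hright : ContinuousWithinAt (cdf ν) (Set.Ioi t) t :=
    ((cdf ν).right_continuous t).mono Set.Ioi_subset_Ici_self
  refine ge_of_tendsto hright ?_
  filter_upwards [self_mem_nhdsWithin] with s hs
  obtain ⟨r, hr, hrs⟩ := (csInf_lt_iff hbdd hne).1 (lt_of_le_of_lt h hs)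
  exact le_trans hr (monotone_cdf ν hrs.le)

theorem aemeasurable_leftQuantile_cdf (ν : Measure ℝ) [IsProbabilityMeasure ν] :
    AEMeasurable (leftQuantile (cdf ν)) (volume.restrict (Set.Ioo (0:ℝ) 1)) := by
  refine aemeasurable_restrict_of_monotoneOn measurableSet_Ioo fun u hu v hv huv => ?_
  rw [leftQuantile_cdf_le_iff ν hu]
  exact huv.trans ((leftQuantile_cdf_le_iff ν hv _).1 le_rfl)

/-- The quantile transform: the quantile function of `ν` has law `ν` under the uniform law. -/
theorem map_leftQuantile_cdf (ν : Measure ℝ) [IsProbabilityMeasure ν] :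
    (volume.restrict (Set.Ioo (0:ℝ) 1)).map (leftQuantile (cdf ν)) = ν := by
  have hm := aemeasurable_leftQuantile_cdf ν
  have : IsProbabilityMeasure (volume.restrict (Set.Ioo (0:ℝ) 1)) := ⟨by simp⟩
  have := Measure.isProbabilityMeasure_map hm
  refine Measure.ext_of_Iic _ _ fun t => ?_
  rw [Measure.map_apply_of_aemeasurable hm measurableSet_Iic, ← ofReal_cdf]
  have h1 : leftQuantile (cdf ν) ⁻¹' Set.Iic t
      =ᵐ[volume.restrict (Set.Ioo (0:ℝ) 1)] Set.Iic (cdf ν t) := by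
    filter_upwards [ae_restrict_mem measurableSet_Ioo] with u hu
    exact propext (leftQuantile_cdf_le_iff ν hu t)
  rw [measure_congr h1, Measure.restrict_congr_set Ioo_ae_eq_Ioc,
    Measure.restrict_apply measurableSet_Iic, Set.inter_comm, Set.Ioc_inter_Iic,
    Real.volume_Ioc, sub_zero, min_eq_right (cdf_le_one ν t)]

/-- If `f` is convex, nondecreasing and bounded below and `f (2 * |q|)` is integrable, then every
translate `f (q + x)` is integrable. -/
theorem integrable_comp_add_of_orlicz {α : Type*} [MeasurableSpace α] {μ : Measure α}
    [IsFiniteMeasure μ] {f : ℝ → ℝ} {q : α → ℝ} (hf : ConvexOn ℝ Set.univ f) (hmono : Monotone f)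
    {c : ℝ} (hc : ∀ y, c ≤ f y) (hq : AEMeasurable q μ)
    (hint : Integrable (fun u => f (2 * |q u|)) μ) (x : ℝ) :
    Integrable (fun u => f (q u + x)) μ := by
  have hcont := continuous_of_convexOn_univ hf
  refine integrable_of_le_of_le
    (hcont.measurable.comp_aemeasurable (hq.add_const x)).aestronglyMeasurable
    (Eventually.of_forall fun u => hc _) (Eventually.of_forall fun u => ?_)
    (integrable_const c) ((hint.const_mul (1/2)).add (integrable_const (1/2 * f (2 * |x|))))
  have h1 : f (q u + x) ≤ f (|q u| + |x|) :=
    hmono (add_le_add (le_abs_self _) (le_abs_self _))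
  have h2 := hf.2 (mem_univ (2 * |q u|)) (mem_univ (2 * |x|)) (by norm_num : (0:ℝ) ≤ 1/2)
      (by norm_num : (0:ℝ) ≤ 1/2) (by norm_num)
  simp only [smul_eq_mul] at h2
  rw [show 1 / 2 * (2 * |q u|) + 1 / 2 * (2 * |x|) = |q u| + |x| by ring] at h2
  exact h1.trans h2

/-- **Basic properties of the function of certainty equivalents** (Proposition
`function of certainty equivalents basic properties`).  For every distribution
function `F` of a random variable in the Orlicz heart: `φ_{Φ*}(F,·)` is convex
with a nonempty compact interval of minimizers, and its one-sided derivatives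
are given by integrating the one-sided derivatives of `Φ*`. -/
theorem certainty_equivalent_function_properties
    {Ω : Type*} [MeasurableSpace Ω] (P : Measure Ω) [IsProbabilityMeasure P]
    (hatomless : ∀ s : Set Ω, MeasurableSet s → 0 < P s →
      ∃ t, t ⊆ s ∧ MeasurableSet t ∧ 0 < P t ∧ P t < P s)
    -- Φ and its Fenchel-Legendre transform
    (Φ : ℝ → ℝ≥0∞) (Φs : ℝ → ℝ)
    (hΦlsc : LowerSemicontinuous Φ)
    (hΦconv : ∀ x y a b : ℝ, 0 ≤ x → 0 ≤ y → 0 ≤ a → 0 ≤ b → a + b = 1 →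
      Φ (a * x + b * y) ≤ ENNReal.ofReal a * Φ x + ENNReal.ofReal b * Φ y)
    (hΦ0 : Φ 0 ≠ ⊤)
    (hΦdom : ∃ x : ℝ, 1 < x ∧ Φ x ≠ ⊤)
    (hΦinf : sInf (Φ '' Set.Ici (0:ℝ)) = 0)
    (hΦgrow : ∀ c : ℝ, ∀ᶠ x : ℝ in Filter.atTop, ENNReal.ofReal (c * x) ≤ Φ x)
    (hΦs : ∀ y : ℝ, IsLUB {r : ℝ | ∃ x : ℝ, 0 ≤ x ∧ Φ x ≠ ⊤ ∧ r = x * y - (Φ x).toReal} (Φs y))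
    -- one-sided derivatives of Φ*
    (Φsl Φsr : ℝ → ℝ)
    (hΦsl : ∀ y : ℝ, HasDerivWithinAt Φs (Φsl y) (Set.Iic y) y)
    (hΦsr : ∀ y : ℝ, HasDerivWithinAt Φs (Φsr y) (Set.Ici y) y) :
    ∀ F : ℝ → ℝ,
      -- F belongs to 𝔽_{Φ*}: F is the distribution function of some X ∈ H^{Φ*}
      (∃ X : Ω → ℝ, Measurable X ∧
        (∀ c : ℝ, 0 < c → Integrable (fun ω => Φs (c * |X ω|)) P) ∧
        ∀ t : ℝ, F t = (P {ω | X ω ≤ t}).toReal) →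
      -- 1) convexity and the structure of the set of minimizers
      (ConvexOn ℝ Set.univ (fun x => ocePhi Φs F x) ∧
        ∃ a b : ℝ, a ≤ b ∧ Mmin Φs F = Set.Icc a b) ∧
      -- 2) the one-sided derivatives of φ_{Φ*}(F,·)
      (∀ x : ℝ,
        HasDerivWithinAt (fun y => ocePhi Φs F y)
          ((∫ u in Set.Ioo (0:ℝ) 1, Φsl (leftQuantile F u + x)) - 1)
          (Set.Iic x) x ∧
        HasDerivWithinAt (fun y => ocePhi Φs F y)
          ((∫ u in Set.Ioo (0:ℝ) 1, Φsr (leftQuantile F u + x)) - 1)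
          (Set.Ici x) x) := by
  rintro F ⟨X, hX, hXint, hF⟩
  obtain ⟨x₀, hx₀, hΦx₀⟩ := hΦdom
  have hconv : ConvexOn ℝ Set.univ Φs := by
    refine convexOn_of_isLUB_affine (S := {p | 0 ≤ p.1 ∧ Φ p.1 ≠ ⊤ ∧ p.2 = (Φ p.1).toReal})
      fun y => ?_
    convert hΦs y using 1
    ext r
    constructor
    · rintro ⟨⟨p, v⟩, ⟨h1, h2, h3⟩, rfl⟩
      exact ⟨p, h1, h2, by rw [h3]⟩
    · rintro ⟨p, h1, h2, rfl⟩
      exact ⟨(p, _), ⟨h1, h2, rfl⟩, rfl⟩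
  have hmono : Monotone Φs := by
    intro y z hyz
    refine (hΦs y).2 ?_
    rintro r ⟨p, h1, h2, rfl⟩
    have := (hΦs z).1 ⟨p, h1, h2, rfl⟩
    linarith [mul_le_mul_of_nonneg_left hyz h1]
  have hlow : ∀ y, -(Φ 0).toReal ≤ Φs y := fun y =>
    (hΦs y).1 ⟨0, le_rfl, hΦ0, by ring⟩
  have hlow₀ : ∀ y, x₀ * y - (Φ x₀).toReal ≤ Φs y := fun y =>
    (hΦs y).1 ⟨x₀, by linarith, hΦx₀, rfl⟩
  have : IsProbabilityMeasure (P.map X) := Measure.isProbabilityMeasure_map hX.aemeasurable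
  have hFcdf : F = cdf (P.map X) := by
    ext t
    rw [hF, cdf_eq_real, measureReal_def, Measure.map_apply hX measurableSet_Iic]
    rfl
  have hq : AEMeasurable (leftQuantile F) (volume.restrict (Set.Ioo (0:ℝ) 1)) := by
    rw [hFcdf]; exact aemeasurable_leftQuantile_cdf _
  have hmap : (volume.restrict (Set.Ioo (0:ℝ) 1)).map (leftQuantile F) = P.map X := by
    rw [hFcdf]; exact map_leftQuantile_cdf _
  have : IsProbabilityMeasure (volume.restrict (Set.Ioo (0:ℝ) 1)) := ⟨by simp⟩
  have hcont := continuous_of_convexOn_univ hconv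
  have hqint : ∀ c : ℝ, 0 < c → Integrable (fun u => Φs (c * |leftQuantile F u|))
      (volume.restrict (Set.Ioo (0:ℝ) 1)) := by
    intro c hc
    have hg : Continuous fun y : ℝ => Φs (c * |y|) := by fun_prop
    have h1 : Integrable (fun y : ℝ => Φs (c * |y|)) (P.map X) :=
      (integrable_map_measure hg.aestronglyMeasurable hX.aemeasurable).2 (hXint c hc)
    rw [← hmap] at h1
    exact (integrable_map_measure hg.aestronglyMeasurable hq).1 h1
  have hint := integrable_comp_add_of_orlicz hconv hmono hlow hq (hqint 2 two_pos)
  have hφconv : ConvexOn ℝ Set.univ (fun x => ocePhi Φs F x) := by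
    refine ⟨convex_univ, fun y _ z _ a b ha hb hab => ?_⟩
    have h1 : ∫ u in Set.Ioo (0:ℝ) 1, Φs (leftQuantile F u + (a * y + b * z)) ≤
        ∫ u in Set.Ioo (0:ℝ) 1,
          (a * Φs (leftQuantile F u + y) + b * Φs (leftQuantile F u + z)) := by
      refine integral_mono (hint _) (((hint y).const_mul a).add ((hint z).const_mul b)) fun u => ?_
      have := hconv.2 (mem_univ (leftQuantile F u + y)) (mem_univ (leftQuantile F u + z)) ha hb hab
      simp only [smul_eq_mul] at this
      rwa [show a * (leftQuantile F u + y) + b * (leftQuantile F u + z)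
        = leftQuantile F u + (a * y + b * z) by
          linear_combination leftQuantile F u * hab] at this
    rw [integral_add ((hint y).const_mul a) ((hint z).const_mul b), integral_const_mul,
      integral_const_mul] at h1
    simp only [ocePhi, smul_eq_mul]
    linarith
  have hqL1 : Integrable (leftQuantile F) (volume.restrict (Set.Ioo (0:ℝ) 1)) := by
    have hb : Integrable (fun u => x₀⁻¹ * (Φs (1 * |leftQuantile F u|) + (Φ x₀).toReal))
        (volume.restrict (Set.Ioo (0:ℝ) 1)) :=
      ((hqint 1 one_pos).add (integrable_const _)).const_mul _
    refine hb.mono' hq.aestronglyMeasurable (Eventually.of_forall fun u => ?_)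
    have := hlow₀ |leftQuantile F u|
    rw [Real.norm_eq_abs, one_mul, ← div_eq_inv_mul, le_div_iff₀ (by linarith)]
    linarith
  have htop : Tendsto (fun x => ocePhi Φs F x) atTop atTop := by
    have hlin : Tendsto (fun x : ℝ => (x₀ - 1) * x +
        (x₀ * (∫ u in Set.Ioo (0:ℝ) 1, leftQuantile F u) - (Φ x₀).toReal)) atTop atTop :=
      tendsto_atTop_add_const_right _ _ (tendsto_id.const_mul_atTop (by linarith))
    refine tendsto_atTop_mono (fun x => ?_) hlin
    have h1 : ∫ u in Set.Ioo (0:ℝ) 1, (x₀ * leftQuantile F u + (x₀ * x - (Φ x₀).toReal)) ≤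
        ∫ u in Set.Ioo (0:ℝ) 1, Φs (leftQuantile F u + x) := by
      refine integral_mono ((hqL1.const_mul x₀).add (integrable_const _)) (hint x) fun u => ?_
      have := hlow₀ (leftQuantile F u + x)
      simp only
      linarith
    rw [integral_add (hqL1.const_mul x₀) (integrable_const _), integral_const_mul,
      integral_const, probReal_univ, one_smul] at h1
    simp only [ocePhi]
    linarith
  have hbot : Tendsto (fun x => ocePhi Φs F x) atBot atTop := by
    have hlin : Tendsto (fun x : ℝ => -x + -(Φ 0).toReal) atBot atTop :=
      tendsto_atTop_add_const_right _ _ tendsto_neg_atBot_atTop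
    refine tendsto_atTop_mono (fun x => ?_) hlin
    have h1 := integral_mono (integrable_const _) (hint x)
      fun u => hlow (leftQuantile F u + x)
    rw [integral_const, probReal_univ, one_smul] at h1
    simp only [ocePhi]
    linarith
  refine ⟨⟨hφconv, exists_argmin_eq_Icc hφconv htop hbot⟩, fun x => ⟨?_, ?_⟩⟩
  · exact (hasDerivWithinAt_integral_of_convexOn hconv hint (T := Set.Iic)
      (fun y h z => by simp) hΦsl x).sub (hasDerivWithinAt_id x _)
  · exact (hasDerivWithinAt_integral_of_convexOn hconv hint (T := Set.Ici)
      (fun y h z => by simp) hΦsr x).sub (hasDerivWithinAt_id x _)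
end
end
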